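/- Let X be a Banach space over ℝ or ℂ and T : X → X a bounded linear operator. Suppose X = M ⊕ N where M and N are closed T-invariant linear subspaces of X. Then CR(T) = CR(T|_M) ⊕ CR(T|_N): every chain recurrent point x of T decomposes uniquely as x = m + n with m chain recurrent for T|_M and n chain recurrent for T|_N, and conversely every such sum is chain recurrent for T. -/

import Mathlib

/-- An `ε`-chain of `T` from `x` to `y`: a finite sequence `x = c 0, c 1, …, c n = y`
with `n ≥ 1` such that `‖T (c i) - c (i+1)‖ < ε` for every `0 ≤ i < n`. -/
def EpsChain {E : Type*} [NormedAddCommGroup E] (T : E → E) (ε : ℝ) (x y : E) : Prop :=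
  ∃ (n : ℕ) (c : ℕ → E), 1 ≤ n ∧ c 0 = x ∧ c n = y ∧ ∀ i < n, ‖T (c i) - c (i + 1)‖ < ε

/-- `x` is a chain recurrent point of `T` if for every `ε > 0` there is an `ε`-chain
beginning and ending at `x`. -/
def ChainRecurrent {E : Type*} [NormedAddCommGroup E] (T : E → E) (x : E) : Prop :=
  ∀ ε > 0, EpsChain T ε x x

/-- A closed `ε`-chain extends to a periodic infinite one. -/
theorem EpsChain.exists_periodic {E : Type*} [NormedAddCommGroup E] {T : E → E} {ε : ℝ} {x : E}
    (h : EpsChain T ε x x) :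
    ∃ (n : ℕ) (c : ℕ → E), 1 ≤ n ∧ (∀ i, n ∣ i → c i = x) ∧
      ∀ i, ‖T (c i) - c (i + 1)‖ < ε := by
  obtain ⟨n, c, hn, h0, hcn, hc⟩ := h
  refine ⟨n, fun i => c (i % n), hn, fun i hi => ?_, fun i => ?_⟩
  · simp [Nat.mod_eq_zero_of_dvd hi, h0]
  · have hlt : i % n < n := Nat.mod_lt _ hn
    have hstep := hc _ hlt
    have hmod : (i + 1) % n = (i % n + 1) % n := (Nat.mod_add_mod i n 1).symm
    rcases Nat.lt_or_ge (i % n + 1) n with h | h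
    · simpa only [hmod, Nat.mod_eq_of_lt h] using hstep
    · have h_eq : i % n + 1 = n := le_antisymm hlt h
      rw [h_eq, Nat.mod_self] at hmod
      rw [h_eq, hcn] at hstep
      simpa only [hmod, h0] using hstep

/-- Chain recurrence passes to the image under a bounded linear semiconjugacy. -/
theorem ChainRecurrent.map {𝕜 E F : Type*} [NontriviallyNormedField 𝕜] [NormedAddCommGroup E]
    [NormedSpace 𝕜 E] [NormedAddCommGroup F] [NormedSpace 𝕜 F] {T : E → E} {S : F → F}
    (P : E →L[𝕜] F) (hP : Function.Semiconj P T S) {x : E} (hx : ChainRecurrent T x) :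
    ChainRecurrent S (P x) := by
  intro ε hε
  have hpos : 0 < ‖P‖ + 1 := by positivity
  obtain ⟨n, c, hn, h0, hcn, hc⟩ := hx (ε / (‖P‖ + 1)) (by positivity)
  refine ⟨n, fun i => P (c i), hn, congrArg P h0, congrArg P hcn, fun i hi => ?_⟩
  calc ‖S (P (c i)) - P (c (i + 1))‖ = ‖P (T (c i) - c (i + 1))‖ := by rw [map_sub, hP.eq]
    _ ≤ ‖P‖ * ‖T (c i) - c (i + 1)‖ := P.le_opNorm _
    _ ≤ (‖P‖ + 1) * ‖T (c i) - c (i + 1)‖ := by gcongr; linarith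
    _ < ε := (lt_div_iff₀' hpos).1 (hc i hi)

/-- The sum of two chain recurrent points of an additive map is chain recurrent. -/
theorem ChainRecurrent.add {E : Type*} [NormedAddCommGroup E] {T : E → E}
    (hT : ∀ a b, T (a + b) = T a + T b) {x y : E} (hx : ChainRecurrent T x)
    (hy : ChainRecurrent T y) : ChainRecurrent T (x + y) := by
  intro ε hε
  obtain ⟨n, c, hn, hcx, hc⟩ := (hx (ε / 2) (half_pos hε)).exists_periodic
  obtain ⟨k, d, hk, hdy, hd⟩ := (hy (ε / 2) (half_pos hε)).exists_periodic
  refine ⟨n * k, fun i => c i + d i, Nat.mul_pos hn hk, ?_, ?_, fun i _ => ?_⟩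
  · simp only [hcx 0 (dvd_zero n), hdy 0 (dvd_zero k)]
  · simp only [hcx _ (dvd_mul_right n k), hdy _ (dvd_mul_left k n)]
  · calc ‖T (c i + d i) - (c (i + 1) + d (i + 1))‖
        = ‖(T (c i) - c (i + 1)) + (T (d i) - d (i + 1))‖ := by rw [hT, add_sub_add_comm]
      _ ≤ ‖T (c i) - c (i + 1)‖ + ‖T (d i) - d (i + 1)‖ := norm_add_le _ _
      _ < ε := by linarith [hc i, hd i]

/-- The projection onto an invariant subspace along an invariant complement intertwines the
operator with its restriction. -/
theorem Submodule.semiconj_projectionOntoL {𝕜 X : Type*} [NontriviallyNormedField 𝕜]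
    [NormedAddCommGroup X] [NormedSpace 𝕜 X] (T : X →L[𝕜] X) {M N : Submodule 𝕜 X}
    (hMi : ∀ x ∈ M, T x ∈ M) (hNi : ∀ x ∈ N, T x ∈ N) (h : M.IsTopCompl N) :
    Function.Semiconj (M.projectionOntoL N h) T (fun a : M => (⟨T a, hMi a a.2⟩ : M)) := by
  intro x
  obtain ⟨m, hm, n, hn, rfl⟩ := Submodule.mem_sup.1
    (h.isCompl.sup_eq_top ▸ Submodule.mem_top : x ∈ M ⊔ N)
  lift m to M using hm
  lift n to N using hn
  have hTm := M.projectionOntoL_apply_left h ⟨T m, hMi m m.2⟩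
  have hTn := M.projectionOntoL_apply_right h ⟨T n, hNi n n.2⟩
  simp_all

theorem stmt_9 {𝕜 : Type*} [RCLike 𝕜] {X : Type*} [NormedAddCommGroup X] [NormedSpace 𝕜 X]
    [CompleteSpace X] (T : X →L[𝕜] X) (M N : Submodule 𝕜 X)
    (hMc : IsClosed (M : Set X)) (hNc : IsClosed (N : Set X))
    (hMi : ∀ x ∈ M, T x ∈ M) (hNi : ∀ x ∈ N, T x ∈ N)
    (hcompl : IsCompl M N) :
    ∀ x : X, ChainRecurrent (⇑T) x ↔
      ∃ (m : M) (n : N), x = (m : X) + (n : X) ∧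
        ChainRecurrent (fun a : M => (⟨T a, hMi a a.2⟩ : M)) m ∧
        ChainRecurrent (fun b : N => (⟨T b, hNi b b.2⟩ : N)) n := by
  have h : M.IsTopCompl N := Submodule.IsCompl.isTopCompl_of_isClosed hcompl hMc hNc
  intro x
  constructor
  · intro hx
    refine ⟨M.projectionOntoL N h x, N.projectionOntoL M h.symm x, ?_,
      hx.map _ (Submodule.semiconj_projectionOntoL T hMi hNi h),
      hx.map _ (Submodule.semiconj_projectionOntoL T hNi hMi h.symm)⟩
    simpa using (DFunLike.congr_fun (Submodule.projectionL_add_projectionL_eq_id h) x).symm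
  · rintro ⟨m, n, rfl, hm, hn⟩
    exact (hm.map M.subtypeL fun _ => rfl).add (map_add T) (hn.map N.subtypeL fun _ => rfl)
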